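/- Let G be a finitely generated virtually abelian group, Σ a finite subset of G generating G as a monoid, ω : Σ → ℕ₊ a weight function, and φ an endomorphism of G. Fix g ∈ G and for each r ∈ ℕ let b(r) denote the number of elements h of the φ-twisted conjugacy class [g]_φ with ω(h) ≤ r. Then the relative growth series ∑_{r=0}^∞ b(r) z^r ∈ ℚ[[z]] is a rational function: there exist polynomials p, q ∈ ℚ[z] with q(0) ≠ 0 such that q · (∑_{r=0}^∞ b(r) z^r) = p as formal power series. -/

import Mathlib

open scoped Classical

/-- The weight of a group element induced by a weight function `ω` on a generating set `S`:
`0` for the identity, and otherwise the minimum total weight of a word over `S`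
representing the element. -/
noncomputable def inducedWeight {G : Type*} [Group G] (S : Finset G) (ω : G → ℕ) (g : G) : ℕ :=
  if g = 1 then 0
  else sInf {w : ℕ | ∃ l : List G, (∀ s ∈ l, s ∈ S) ∧ l.prod = g ∧ (l.map ω).sum = w}

section

open scoped Pointwise

/-- A power series over `ℚ` is rational if it is a quotient of polynomials whose denominator has
nonzero constant term. -/
def PowerSeries.IsRational (f : PowerSeries ℚ) : Prop :=
  ∃ p q : Polynomial ℚ, q.coeff 0 ≠ 0 ∧ (q : PowerSeries ℚ) * f = (p : PowerSeries ℚ)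

namespace PowerSeries.IsRational

variable {f g : PowerSeries ℚ}

theorem coe (p : Polynomial ℚ) : IsRational (p : PowerSeries ℚ) :=
  ⟨p, 1, by simp, by simp⟩

theorem add (hf : IsRational f) (hg : IsRational g) : IsRational (f + g) := by
  obtain ⟨p, q, hq, h⟩ := hf
  obtain ⟨p', q', hq', h'⟩ := hg
  refine ⟨q' * p + q * p', q * q', by simp [Polynomial.mul_coeff_zero, hq, hq'], ?_⟩
  push_cast
  rw [← h, ← h']
  ring

theorem neg (hf : IsRational f) : IsRational (-f) := by
  obtain ⟨p, q, hq, h⟩ := hf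
  refine ⟨-p, q, hq, ?_⟩
  push_cast
  rw [← h]
  ring

theorem sub (hf : IsRational f) (hg : IsRational g) : IsRational (f - g) := by
  rw [sub_eq_add_neg]
  exact hf.add hg.neg

theorem sum {ι : Type*} (s : Finset ι) {f : ι → PowerSeries ℚ} (hf : ∀ i ∈ s, IsRational (f i)) :
    IsRational (∑ i ∈ s, f i) := by
  induction s using Finset.cons_induction with
  | empty => simpa using coe 0
  | cons i s hi ih =>
    rw [Finset.sum_cons]
    exact (hf i (by simp)).add (ih fun j hj => hf j (by simp [hj]))

theorem of_one_sub_X_pow_mul {k : ℕ} (hk : k ≠ 0)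
    (hf : IsRational ((1 - PowerSeries.X ^ k) * f)) : IsRational f := by
  obtain ⟨p, q, hq, h⟩ := hf
  refine ⟨p, q * (1 - Polynomial.X ^ k), ?_, ?_⟩
  · simpa [Polynomial.mul_coeff_zero, Polynomial.coeff_X_pow, hk.symm] using hq
  · push_cast
    rw [← h, mul_assoc]

end PowerSeries.IsRational

/-- Every set of a well-quasi-ordered type is dominated from below by a finite subset. -/
theorem Set.exists_finite_subset_forall_exists_le {α : Type*} [PartialOrder α]
    [WellQuasiOrderedLE α] (s : Set α) :
    ∃ t ⊆ s, t.Finite ∧ ∀ x ∈ s, ∃ y ∈ t, y ≤ x := by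
  refine ⟨{x | Minimal (· ∈ s) x}, fun x hx => hx.prop,
    WellQuasiOrderedLE.finite_of_isAntichain (setOfPred_minimal_antichain _), fun x hx => ?_⟩
  obtain ⟨y, hyx, hy⟩ := exists_minimal_le_of_wellFoundedLT (· ∈ s) x hx
  exact ⟨y, hy, hyx⟩

section Translates

variable {M : Type*}

/-- A set is a finite union of translates of the submonoid `P`. -/
def IsFiniteUnionTranslates [AddCommMonoid M] (P : AddSubmonoid M) (U : Set M) : Prop :=
  ∃ F : Set M, F.Finite ∧ U = F + (P : Set M)

theorem AddSubmonoid.FG.exists_addMonoidHom [AddCommMonoid M] {P : AddSubmonoid M} (hP : P.FG) :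
    ∃ (n : ℕ) (f : (Fin n → ℕ) →+ M), ∀ x, x ∈ P ↔ ∃ v, f v = x := by
  obtain ⟨n, f, rfl⟩ := AddSubmonoid.fg_iff_exists_fin_addMonoidHom.1 hP
  exact ⟨n, f, fun x => AddMonoidHom.mem_mrange⟩

theorem AddSubmonoid.FG.inf [AddCancelCommMonoid M] {P₁ P₂ : AddSubmonoid M} (h₁ : P₁.FG)
    (h₂ : P₂.FG) : (P₁ ⊓ P₂).FG := by
  obtain ⟨n₁, f₁, hf₁⟩ := h₁.exists_addMonoidHom
  obtain ⟨n₂, f₂, hf₂⟩ := h₂.exists_addMonoidHom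
  have h := (AddSubmonoid.fg_eqLocusM (f₁.comp (AddMonoidHom.fst _ (Fin n₂ → ℕ)))
    (f₂.comp (AddMonoidHom.snd (Fin n₁ → ℕ) _))).map (f₁.comp (AddMonoidHom.fst _ _))
  convert h
  ext x
  simp only [AddSubmonoid.mem_inf, AddSubmonoid.mem_map, hf₁, hf₂]
  constructor
  · rintro ⟨⟨v, rfl⟩, ⟨u, hu⟩⟩
    exact ⟨(v, u), hu.symm, rfl⟩
  · rintro ⟨⟨v, u⟩, hvu, rfl⟩
    exact ⟨⟨v, rfl⟩, ⟨u, hvu.symm⟩⟩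

theorem IsFiniteUnionTranslates.of_subset [AddCommMonoid M] {P : AddSubmonoid M} (hP : P.FG)
    {U W : Set M} (hU : IsFiniteUnionTranslates P U) (hWU : W ⊆ U)
    (hW : ∀ x ∈ W, ∀ y ∈ P, x + y ∈ W) : IsFiniteUnionTranslates P W := by
  obtain ⟨n, f, hf⟩ := hP.exists_addMonoidHom
  obtain ⟨F, hF, rfl⟩ := hU
  choose D hDs hD hle using fun a : M =>
    Set.exists_finite_subset_forall_exists_le {v : Fin n → ℕ | a + f v ∈ W}
  refine ⟨⋃ a ∈ F, (fun v => a + f v) '' D a, hF.biUnion fun a _ => (hD a).image _, ?_⟩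
  ext x
  simp only [Set.mem_add, Set.mem_iUnion, Set.mem_image, SetLike.mem_coe]
  constructor
  · intro hx
    obtain ⟨a, ha, p, hp, rfl⟩ := hWU hx
    obtain ⟨v, rfl⟩ := (hf p).1 hp
    obtain ⟨u, hu, huv⟩ := hle a v hx
    obtain ⟨d, rfl⟩ := exists_add_of_le huv
    exact ⟨_, ⟨a, ha, u, hu, rfl⟩, f d, (hf _).2 ⟨d, rfl⟩, by rw [map_add, add_assoc]⟩
  · rintro ⟨_, ⟨a, ha, u, hu, rfl⟩, p, hp, rfl⟩
    exact hW _ (hDs a hu) _ hp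

theorem IsFiniteUnionTranslates.inter [AddCancelCommMonoid M] {P₁ P₂ : AddSubmonoid M}
    (h₁ : P₁.FG) (h₂ : P₂.FG) {U₁ U₂ : Set M} (hU₁ : IsFiniteUnionTranslates P₁ U₁)
    (hU₂ : IsFiniteUnionTranslates P₂ U₂) : IsFiniteUnionTranslates (P₁ ⊓ P₂) (U₁ ∩ U₂) := by
  obtain ⟨n₁, f₁, hf₁⟩ := h₁.exists_addMonoidHom
  obtain ⟨n₂, f₂, hf₂⟩ := h₂.exists_addMonoidHom
  obtain ⟨F₁, hF₁, rfl⟩ := hU₁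
  obtain ⟨F₂, hF₂, rfl⟩ := hU₂
  choose D hDs hD hle using fun a : M × M => Set.exists_finite_subset_forall_exists_le
    {v : (Fin n₁ → ℕ) × (Fin n₂ → ℕ) | a.1 + f₁ v.1 = a.2 + f₂ v.2}
  refine ⟨⋃ a ∈ F₁ ×ˢ F₂, (fun v => a.1 + f₁ v.1) '' D a,
    (hF₁.prod hF₂).biUnion fun a _ => (hD a).image _, ?_⟩
  ext x
  simp only [Set.mem_add, Set.mem_iUnion, Set.mem_image, SetLike.mem_coe, Set.mem_inter_iff,
    Set.mem_prod, AddSubmonoid.mem_inf]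
  constructor
  · rintro ⟨⟨a, ha, p, hp, rfl⟩, ⟨b, hb, q, hq, hpq⟩⟩
    obtain ⟨v, rfl⟩ := (hf₁ p).1 hp
    obtain ⟨u, rfl⟩ := (hf₂ q).1 hq
    obtain ⟨⟨v', u'⟩, h', hvu⟩ := hle (a, b) (v, u) hpq.symm
    obtain ⟨⟨d, e⟩, hde⟩ := exists_add_of_le hvu
    obtain ⟨rfl, rfl⟩ := Prod.ext_iff.1 hde
    refine ⟨_, ⟨(a, b), ⟨ha, hb⟩, _, h', rfl⟩, f₁ d, ⟨(hf₁ _).2 ⟨d, rfl⟩, (hf₂ _).2 ⟨e, ?_⟩⟩, ?_⟩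
    · have h := hDs (a, b) h'
      simp only [Set.mem_ofPred_eq, Prod.fst_add, Prod.snd_add, map_add, ← add_assoc] at h hpq
      rw [h] at hpq
      exact add_left_cancel hpq
    · simp [add_assoc]
  · rintro ⟨_, ⟨⟨a, b⟩, ⟨ha, hb⟩, ⟨v, u⟩, hv, rfl⟩, p, ⟨hp₁, hp₂⟩, rfl⟩
    refine ⟨⟨a, ha, f₁ v + p, add_mem ((hf₁ _).2 ⟨v, rfl⟩) hp₁, (add_assoc ..).symm⟩,
      ⟨b, hb, f₂ u + p, add_mem ((hf₂ _).2 ⟨u, rfl⟩) hp₂, ?_⟩⟩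
    have h := hDs _ hv
    simp only [Set.mem_ofPred_eq] at h
    rw [← add_assoc, h]

end Translates

section WeightSeries

/-- The series counting the elements of `U` by their weight `w`. -/
noncomputable def weightSeries {M : Type*} (w : M → ℕ) (U : Set M) : PowerSeries ℚ :=
  PowerSeries.mk fun r => (Set.ncard {x ∈ U | w x = r} : ℚ)

theorem weightSeries_union_add_inter {M : Type*} (w : M → ℕ) {U V : Set M}
    (hU : ∀ r, {x ∈ U | w x = r}.Finite) (hV : ∀ r, {x ∈ V | w x = r}.Finite) :
    weightSeries w (U ∪ V) + weightSeries w (U ∩ V) = weightSeries w U + weightSeries w V := by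
  ext r
  simp only [weightSeries, map_add, PowerSeries.coeff_mk]
  have h := Set.ncard_union_add_ncard_inter _ _ (hU r) (hV r)
  have h₁ : {x ∈ U | w x = r} ∪ {x ∈ V | w x = r} = {x ∈ U ∪ V | w x = r} := by
    ext x; simp only [Set.mem_union, Set.mem_ofPred_eq]; tauto
  have h₂ : {x ∈ U | w x = r} ∩ {x ∈ V | w x = r} = {x ∈ U ∩ V | w x = r} := by
    ext x; simp only [Set.mem_inter_iff, Set.mem_ofPred_eq]; tauto
  rw [h₁, h₂] at h
  exact_mod_cast h

theorem weightSeries_empty {M : Type*} (w : M → ℕ) : weightSeries w ∅ = 0 := by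
  ext r
  simp [weightSeries]

theorem weightSeries_sdiff {M : Type*} (w : M → ℕ) {U V : Set M} (hVU : V ⊆ U)
    (hU : ∀ r, {x ∈ U | w x = r}.Finite) :
    weightSeries w (U \ V) = weightSeries w U - weightSeries w V := by
  have h := weightSeries_union_add_inter w (U := U \ V) (V := V)
    (fun r => (hU r).subset fun x hx => ⟨hx.1.1, hx.2⟩)
    (fun r => (hU r).subset fun x hx => ⟨hVU hx.1, hx.2⟩)
  rw [Set.sdiff_union_of_subset hVU, Set.sdiff_inter_self, weightSeries_empty, add_zero] at h
  rw [h, add_sub_cancel_right]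

theorem weightSeries_isRational_of_finite {M : Type*} (w : M → ℕ) {U : Set M} (hU : U.Finite) :
    (weightSeries w U).IsRational := by
  obtain ⟨n, hn⟩ := (hU.image w).bddAbove
  have h : weightSeries w U = (PowerSeries.trunc (n + 1) (weightSeries w U) : Polynomial ℚ) := by
    ext r
    rw [Polynomial.coeff_coe, PowerSeries.coeff_trunc]
    split_ifs with hr
    · rfl
    · have : {x ∈ U | w x = r} = ∅ := by
        ext x
        simp only [Set.mem_ofPred_eq, Set.mem_empty_iff_false, iff_false]
        rintro ⟨hx, rfl⟩
        exact hr (Nat.lt_succ_of_le (hn ⟨x, hx, rfl⟩))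
      simp [weightSeries, this]
  rw [h]
  exact .coe _

variable {M : Type*} [AddCancelCommMonoid M] (w : M →+ ℕ)

theorem weightSeries_vadd (t : M) (U : Set M) :
    weightSeries w ((t + ·) '' U) = PowerSeries.X ^ w t * weightSeries w U := by
  ext r
  rw [PowerSeries.coeff_X_pow_mul']
  simp only [weightSeries, PowerSeries.coeff_mk]
  split_ifs with hr
  · have : {x ∈ (t + ·) '' U | w x = r} = (t + ·) '' {x ∈ U | w x = r - w t} := by
      ext x
      simp only [Set.mem_ofPred_eq, Set.mem_image]
      constructor
      · rintro ⟨⟨y, hy, rfl⟩, h⟩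
        rw [map_add] at h
        exact ⟨y, ⟨hy, by omega⟩, rfl⟩
      · rintro ⟨y, ⟨hy, h⟩, rfl⟩
        exact ⟨⟨y, hy, rfl⟩, by rw [map_add]; omega⟩
    rw [this, Set.ncard_image_of_injective _ (add_right_injective t)]
  · have : {x ∈ (t + ·) '' U | w x = r} = ∅ := by
      ext x
      simp only [Set.mem_ofPred_eq, Set.mem_empty_iff_false, iff_false]
      rintro ⟨⟨y, hy, rfl⟩, h⟩
      rw [map_add] at h
      omega
    rw [this, Set.ncard_empty, Nat.cast_zero]

theorem AddSubmonoid.mem_closure_insert_iff {M : Type*} [AddCommMonoid M] {t x : M} {T : Set M} :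
    x ∈ AddSubmonoid.closure (insert t T) ↔
      ∃ n : ℕ, ∃ y ∈ AddSubmonoid.closure T, n • t + y = x := by
  rw [Set.insert_eq, AddSubmonoid.closure_union, AddSubmonoid.mem_sup]
  simp only [AddSubmonoid.mem_closure_singleton, exists_exists_eq_and]

theorem IsFiniteUnionTranslates.weightSeries_isRational_closure (T : Finset M) (U : Set M)
    (hU : IsFiniteUnionTranslates (AddSubmonoid.closure (T : Set M)) U)
    (hfin : ∀ r, {x ∈ U | w x = r}.Finite) : (weightSeries w U).IsRational := by
  induction T using Finset.induction_on generalizing U with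
  | empty =>
    obtain ⟨F, hF, rfl⟩ := hU
    simpa using weightSeries_isRational_of_finite w hF
  | insert t T _ ih =>
    obtain ⟨F, hF, hUF⟩ := hU
    have hmem : ∀ x, x ∈ U ↔ ∃ a ∈ F, ∃ n : ℕ,
        ∃ y ∈ AddSubmonoid.closure (T : Set M), a + (n • t + y) = x := by
      intro x
      simp only [hUF, Set.mem_add, SetLike.mem_coe, Finset.coe_insert,
        AddSubmonoid.mem_closure_insert_iff]
      grind
    by_cases hwt : w t = 0
    · obtain rfl | ⟨a, ha⟩ := F.eq_empty_or_nonempty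
      · rw [hUF, Set.empty_add, weightSeries_empty]
        exact .coe 0
      have hninj : ¬ Function.Injective fun n : ℕ => a + n • t := by
        intro hinj
        refine Set.infinite_range_of_injective hinj ((hfin (w a)).subset ?_)
        rintro _ ⟨n, rfl⟩
        exact ⟨(hmem _).2 ⟨a, ha, n, 0, zero_mem _, by simp⟩, by simp [hwt]⟩
      obtain ⟨p, hp, hpt⟩ : ∃ p : ℕ, 0 < p ∧ p • t = 0 := by
        simp only [Function.Injective, not_forall] at hninj
        obtain ⟨i, j, hij, hne⟩ := hninj
        replace hij := add_left_cancel hij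
        wlog hlt : i < j generalizing i j
        · exact this j i (Ne.symm hne) hij.symm (by omega)
        refine ⟨j - i, by omega, ?_⟩
        obtain ⟨k, rfl⟩ := Nat.exists_eq_add_of_lt hlt
        have h : i • t + 0 = i • t + (k + 1) • t := by
          rw [← add_nsmul, add_zero, hij]; rfl
        rw [show i + k + 1 - i = k + 1 by omega]
        exact (add_left_cancel h).symm
      refine ih U ⟨(fun x : M × ℕ => x.1 + x.2 • t) '' (F ×ˢ Set.Iio p),
        (hF.prod (Set.finite_Iio p)).image _, ?_⟩ hfin
      ext x
      simp only [hmem, Set.mem_add, Set.mem_image, Set.mem_prod, Set.mem_Iio, SetLike.mem_coe]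
      constructor
      · rintro ⟨b, hb, n, y, hy, rfl⟩
        refine ⟨_, ⟨(b, n % p), ⟨hb, Nat.mod_lt _ hp⟩, rfl⟩, y, hy, ?_⟩
        conv_rhs => rw [← Nat.mod_add_div n p, add_nsmul, mul_comm p, mul_nsmul', hpt, nsmul_zero,
          add_zero]
        rw [add_assoc]
      · rintro ⟨_, ⟨⟨b, n⟩, ⟨hb, -⟩, rfl⟩, y, hy, rfl⟩
        exact ⟨b, hb, n, y, hy, (add_assoc ..).symm⟩
    · have htU : (t + ·) '' U ⊆ U := by
        rintro _ ⟨x, hx, rfl⟩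
        obtain ⟨a, ha, n, y, hy, rfl⟩ := (hmem x).1 hx
        refine (hmem _).2 ⟨a, ha, n + 1, y, hy, ?_⟩
        simp only [add_nsmul, one_nsmul]
        abel
      set V : Set M := F + (AddSubmonoid.closure (T : Set M) : Set M) with hV
      have hVU : V ⊆ U := by
        rintro _ ⟨a, ha, y, hy, rfl⟩
        exact (hmem _).2 ⟨a, ha, 0, y, hy, by simp⟩
      have hVfin : ∀ r, {x ∈ V | w x = r}.Finite :=
        fun r => (hfin r).subset fun x hx => ⟨hVU hx.1, hx.2⟩
      have hdiff : U \ (t + ·) '' U = V \ (V ∩ (t + ·) '' U) := by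
        ext x
        constructor
        · rintro ⟨hx, hxt⟩
          refine ⟨?_, fun h => hxt h.2⟩
          obtain ⟨a, ha, n, y, hy, rfl⟩ := (hmem x).1 hx
          cases n with
          | zero => exact ⟨a, ha, y, hy, by simp⟩
          | succ n =>
            refine absurd ⟨_, (hmem _).2 ⟨a, ha, n, y, hy, rfl⟩, ?_⟩ hxt
            simp only [add_nsmul, one_nsmul]
            abel
        · rintro ⟨hx, hxt⟩
          exact ⟨hVU hx, fun h => hxt ⟨hx, h⟩⟩
      refine PowerSeries.IsRational.of_one_sub_X_pow_mul hwt ?_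
      rw [sub_mul, one_mul, ← weightSeries_vadd, ← weightSeries_sdiff _ htU hfin, hdiff,
        weightSeries_sdiff _ Set.inter_subset_left hVfin]
      refine (ih V ⟨F, hF, rfl⟩ hVfin).sub (ih _ ?_ fun r => (hVfin r).subset
        fun x hx => ⟨hx.1.1, hx.2⟩)
      refine IsFiniteUnionTranslates.of_subset ⟨T, rfl⟩ ⟨F, hF, rfl⟩ Set.inter_subset_left ?_
      rintro _ ⟨⟨a, ha, y, hy, rfl⟩, x, hx, hxy⟩ z hz
      refine ⟨⟨a, ha, y + z, add_mem hy hz, (add_assoc ..).symm⟩, ?_⟩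
      obtain ⟨b, hb, n, u, hu, rfl⟩ := (hmem x).1 hx
      refine ⟨_, (hmem _).2 ⟨b, hb, n, u + z, add_mem hu hz, rfl⟩, ?_⟩
      simp only [← hxy, add_assoc]

theorem IsFiniteUnionTranslates.weightSeries_isRational {P : AddSubmonoid M} (hP : P.FG)
    {U : Set M} (hU : IsFiniteUnionTranslates P U) (hfin : ∀ r, {x ∈ U | w x = r}.Finite) :
    (weightSeries w U).IsRational := by
  obtain ⟨T, rfl⟩ := hP
  exact weightSeries_isRational_closure w T U hU hfin

theorem IsFiniteUnionTranslates.weightSeries_isRational_iUnion (n : ℕ)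
    (P : Fin n → AddSubmonoid M) (hP : ∀ i, (P i).FG) (U : Fin n → Set M)
    (hU : ∀ i, IsFiniteUnionTranslates (P i) (U i))
    (hfin : ∀ r, {x ∈ ⋃ i, U i | w x = r}.Finite) :
    (weightSeries w (⋃ i, U i)).IsRational := by
  induction n with
  | zero =>
    rw [Set.iUnion_of_empty, weightSeries_empty]
    exact .coe 0
  | succ n ih =>
    have hsub : ∀ V ⊆ ⋃ i, U i, ∀ r, {x ∈ V | w x = r}.Finite :=
      fun V hV r => (hfin r).subset fun x hx => ⟨hV hx.1, hx.2⟩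
    have h₀ : U 0 ⊆ ⋃ i, U i := Set.subset_iUnion U 0
    have h₁ : ⋃ i : Fin n, U i.succ ⊆ ⋃ i, U i :=
      Set.iUnion_subset fun i => Set.subset_iUnion U i.succ
    have hunion : ⋃ i, U i = U 0 ∪ ⋃ i : Fin n, U i.succ := by
      ext x
      simp [Fin.exists_fin_succ]
    have hinter : U 0 ∩ ⋃ i : Fin n, U i.succ = ⋃ i : Fin n, U 0 ∩ U i.succ :=
      Set.inter_iUnion _ _
    have h := weightSeries_union_add_inter w (hsub _ h₀) (hsub _ h₁)
    rw [hunion, eq_sub_of_add_eq h, hinter]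
    refine ((weightSeries_isRational w (hP 0) (hU 0) (hsub _ h₀)).add
      (ih _ (fun i => hP i.succ) _ (fun i => hU i.succ) (hsub _ h₁))).sub
      (ih (fun i => P 0 ⊓ P i.succ) (fun i => (hP 0).inf (hP i.succ)) _
        (fun i => (hU 0).inter (hP 0) (hP i.succ) (hU i.succ)) (hsub _ ?_))
    exact hinter ▸ Set.inter_subset_left.trans h₀

/-- The series counting the elements of a semilinear set by an additive weight is rational. -/
theorem IsSemilinearSet.weightSeries_isRational {U : Set M} (hU : IsSemilinearSet U)
    (hfin : ∀ r, {x ∈ U | w x = r}.Finite) : (weightSeries w U).IsRational := by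
  obtain ⟨L, hL, hlin, rfl⟩ := hU
  obtain ⟨n, e, -, he⟩ := hL.fin_param
  have hlin' : ∀ i, IsLinearSet (e i) := fun i => hlin _ (he ▸ Set.mem_range_self i)
  choose a P hP ha using fun i => isLinearSet_iff_exists_fg_eq_vadd.1 (hlin' i)
  have hL' : ⋃₀ L = ⋃ i, e i := by rw [← he, Set.sUnion_range]
  rw [hL'] at hfin ⊢
  refine IsFiniteUnionTranslates.weightSeries_isRational_iUnion w n P hP e (fun i => ?_) hfin
  refine ⟨{a i}, Set.finite_singleton _, ?_⟩
  rw [ha i, Set.singleton_add]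
  rfl

end WeightSeries

section PathSum

variable {M Q : Type*} [AddCommMonoid M]

/-- `PathSum E X p q m` says that `m` is the sum of the labels of a nonempty path from `p` to `q`
all of whose intermediate vertices lie in `X`; the labels of edges from `p` to `q` form the
set `E p q`. -/
inductive PathSum (E : Q → Q → Set M) (X : Set Q) : Q → Q → M → Prop
  | edge {p q : Q} {m : M} (hm : m ∈ E p q) : PathSum E X p q m
  | cons {p x q : Q} {m m' : M} (hm : m ∈ E p x) (hx : x ∈ X) (h : PathSum E X x q m') :
    PathSum E X p q (m + m')

namespace PathSum

variable {E : Q → Q → Set M} {X Y : Set Q} {p x q : Q} {m m' : M}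

theorem mono (hXY : X ⊆ Y) (h : PathSum E X p q m) : PathSum E Y p q m := by
  induction h with
  | edge hm => exact .edge hm
  | cons hm hx _ ih => exact .cons hm (hXY hx) ih

theorem trans (h : PathSum E X p x m) (hx : x ∈ X) (h' : PathSum E X x q m') :
    PathSum E X p q (m + m') := by
  induction h with
  | edge hm => exact .cons hm hx h'
  | cons hm hy _ ih =>
    rw [add_assoc]
    exact .cons hm hy (ih hx h')

theorem closure_add (hx : x ∈ X) (hm : m ∈ AddSubmonoid.closure {c | PathSum E X x x c})
    (h : PathSum E X x q m') : PathSum E X x q (m + m') := by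
  induction hm using AddSubmonoid.closure_induction generalizing m' with
  | mem c hc => exact hc.trans hx h
  | zero => rwa [zero_add]
  | add a b _ _ iha ihb =>
    rw [add_assoc]
    exact iha (ihb h)

theorem setOf_insert_eq : {m | PathSum E (insert x X) p q m} = {m | PathSum E X p q m} ∪
    ({m | PathSum E X p x m} + (AddSubmonoid.closure {m | PathSum E X x x m} : Set M) +
      {m | PathSum E X x q m}) := by
  ext m
  constructor
  · intro h
    simp only [Set.mem_ofPred_eq] at h
    induction h with
    | edge hm => exact Or.inl (.edge hm)
    | @cons p y q m m' hm hy h ih =>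
      obtain rfl | hy := hy
      · right
        obtain h' | ⟨_, ⟨a, ha, c, hc, rfl⟩, b, hb, rfl⟩ := ih
        · exact ⟨_, ⟨m, .edge hm, 0, zero_mem _, rfl⟩, m', h', by simp⟩
        · exact ⟨_, ⟨m, .edge hm, a + c, add_mem (AddSubmonoid.subset_closure ha) hc, rfl⟩, b, hb,
            by simp only [add_assoc]⟩
      · obtain h' | ⟨_, ⟨a, ha, c, hc, rfl⟩, b, hb, rfl⟩ := ih
        · exact Or.inl (.cons hm hy h')
        · exact Or.inr ⟨_, ⟨m + a, .cons hm hy ha, c, hc, rfl⟩, b, hb, by simp only [add_assoc]⟩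
  · have hX : X ⊆ insert x X := Set.subset_insert x X
    have hx : x ∈ insert x X := Set.mem_insert x X
    rintro (h | ⟨_, ⟨a, ha, c, hc, rfl⟩, b, hb, rfl⟩)
    · exact h.mono hX
    · simp only [add_assoc]
      refine (ha.mono hX).trans hx (closure_add hx ?_ (hb.mono hX))
      exact AddSubmonoid.closure_mono (fun d hd => PathSum.mono hX hd) hc

theorem isSemilinearSet [Finite Q] (hE : ∀ p q, IsSemilinearSet (E p q)) (p q : Q) :
    IsSemilinearSet {m | PathSum E Set.univ p q m} := by
  suffices h : ∀ X : Set Q, X.Finite → ∀ p q, IsSemilinearSet {m | PathSum E X p q m} from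
    h _ Set.finite_univ p q
  intro X hX
  induction X, hX using Set.Finite.induction_on with
  | empty =>
    intro p q
    convert hE p q using 1
    ext m
    constructor
    · rintro (hm | ⟨_, hx, _⟩)
      · exact hm
      · exact absurd hx (Set.notMem_empty _)
    · exact .edge
  | insert _ _ ih =>
    intro p q
    rw [setOf_insert_eq]
    exact (ih p q).union (((ih p _).add (ih _ _).closure).add (ih _ q))

end PathSum

end PathSum

theorem IsSemilinearSet.prod_univ {M N : Type*} [AddCommMonoid M] [AddCommMonoid N]
    [AddMonoid.FG N] {s : Set M} (hs : IsSemilinearSet s) :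
    IsSemilinearSet (s ×ˢ (Set.univ : Set N)) := by
  convert (hs.image (AddMonoidHom.inl M N)).add
    ((IsSemilinearSet.univ (M := N)).image (AddMonoidHom.inr M N)) using 1
  ext ⟨a, b⟩
  simp [Set.mem_add]

section Words

variable {G A Q : Type*} [Group G] [AddCommGroup A] (i : Multiplicative A →* G) (t : Q → G)

/-- The elements of a finitely generated submonoid lying in a fixed coset of a finite-index
abelian subgroup, together with the weights of the words representing them, form a semilinear
set. -/
theorem isSemilinearSet_words [Finite Q] (hi : Function.Injective i)
    (ht : ∀ g, ∃ a q, g = i (.ofAdd a) * t q) (S : Finset G) (ω : G → ℕ) (q : Q) :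
    IsSemilinearSet {x : A × ℕ | ∃ l : List G, (∀ s ∈ l, s ∈ S) ∧
      l.prod = i (.ofAdd x.1) * t q ∧ (l.map ω).sum = x.2} := by
  let E : Q → Q → Set (A × ℕ) := fun p q =>
    {x | ∃ s ∈ S, t p * s = i (.ofAdd x.1) * t q ∧ ω s = x.2}
  have hi' : Function.Injective fun a : A => i (.ofAdd a) := hi.comp Multiplicative.ofAdd.injective
  have hE : ∀ p q, IsSemilinearSet (E p q) := by
    intro p q
    refine .of_finite (Set.Finite.subset (S.finite_toSet.biUnion (t := fun s =>
      {x : A × ℕ | t p * s = i (.ofAdd x.1) * t q ∧ ω s = x.2})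
      fun s _ => Set.Subsingleton.finite ?_) fun x hx => ?_)
    · rintro ⟨a, m⟩ ⟨ha, hm⟩ ⟨b, n⟩ ⟨hb, hn⟩
      exact Prod.ext (hi' (mul_right_cancel (ha.symm.trans hb))) (hm.symm.trans hn)
    · obtain ⟨s, hs, h⟩ := hx
      exact Set.mem_biUnion hs h
  have key : ∀ p x, PathSum E Set.univ p q x ↔ ∃ l : List G, l ≠ [] ∧ (∀ s ∈ l, s ∈ S) ∧
      t p * l.prod = i (.ofAdd x.1) * t q ∧ (l.map ω).sum = x.2 := by
    intro p x
    constructor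
    · intro h
      induction h with
      | edge hm =>
        obtain ⟨s, hs, h, hω⟩ := hm
        exact ⟨[s], by simp, by simpa using hs, by simpa using h, by simpa using hω⟩
      | cons hm _ _ ih =>
        obtain ⟨s, hs, h, hω⟩ := hm
        obtain ⟨l, -, hl, hlp, hlω⟩ := ih
        refine ⟨s :: l, by simp, by simpa using ⟨hs, hl⟩, ?_, by simp [hω, hlω]⟩
        rw [List.prod_cons, ← mul_assoc, h, mul_assoc, hlp, ← mul_assoc, Prod.fst_add, ofAdd_add,
          map_mul]
    · rintro ⟨l, hl, hS, hprod, hω⟩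
      induction l generalizing p x with
      | nil => exact absurd rfl hl
      | cons s l ih =>
        rw [List.forall_mem_cons] at hS
        rw [List.prod_cons] at hprod
        rw [List.map_cons, List.sum_cons] at hω
        obtain rfl | hl' := eq_or_ne l []
        · exact .edge ⟨s, hS.1, by simpa using hprod, by simpa using hω⟩
        · obtain ⟨a, y, hay⟩ := ht (t p * s)
          have h := PathSum.cons (E := E) (X := Set.univ) (p := p) (m := (a, ω s))
            ⟨s, hS.1, hay, rfl⟩ (Set.mem_univ y) (ih y (x.1 - a, (l.map ω).sum) hl' hS.2 ?_ rfl)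
          · convert h using 1
            ext
            · simp
            · exact hω.symm
          · rw [← mul_assoc, hay, mul_assoc] at hprod
            apply mul_left_cancel (a := i (.ofAdd a))
            rw [hprod, ← mul_assoc, ← map_mul, ← ofAdd_add, add_sub_cancel]
  obtain ⟨c, p, hcp⟩ := ht 1
  convert (IsSemilinearSet.of_finite (s := {x : A × ℕ | 1 = i (.ofAdd x.1) * t q ∧ 0 = x.2})
    (Set.Subsingleton.finite ?_)).union
    ((PathSum.isSemilinearSet hE p q).vadd ((c, 0) : A × ℕ)) using 1
  · ext x
    simp only [Set.mem_union, Set.mem_ofPred_eq, Set.mem_vadd_set, key]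
    constructor
    · rintro ⟨l, hl, hprod, hω⟩
      obtain rfl | hl' := eq_or_ne l []
      · exact Or.inl ⟨by simpa using hprod, by simpa using hω⟩
      · refine Or.inr ⟨(x.1 - c, x.2), ⟨l, hl', hl, ?_, hω⟩, by ext <;> simp⟩
        apply mul_left_cancel (a := i (.ofAdd c))
        rw [← mul_assoc, ← hcp, one_mul, hprod, ← mul_assoc, ← map_mul, ← ofAdd_add,
          add_sub_cancel]
    · rintro (⟨h, hω⟩ | ⟨y, ⟨l, -, hl, hprod, hω⟩, rfl⟩)
      · exact ⟨[], by simp, by simpa using h, by simpa using hω⟩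
      · refine ⟨l, hl, ?_, by simp [hω]⟩
        rw [← one_mul l.prod, hcp, mul_assoc, hprod, ← mul_assoc, ← map_mul, ← ofAdd_add]
        rfl
  · rintro ⟨a, m⟩ ⟨ha, hm⟩ ⟨b, n⟩ ⟨hb, hn⟩
    exact Prod.ext (hi' (mul_right_cancel (ha.symm.trans hb))) (hm.symm.trans hn)

end Words

section TwistedConjugacy

variable {G : Type*} [Group G]

open scoped IsMulCommutative in
theorem isSemilinearSet_twistedConjugacyClass [Group.FG G] (N : Subgroup G) [N.Normal]
    [N.FiniteIndex] [IsMulCommutative N] (φ : G →* G) (g h : G) :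
    IsSemilinearSet {a : Additive N | ∃ x : G, a.toMul.1 * h = x * g * (φ x)⁻¹} := by
  let B : Subgroup G := N ⊓ N.comap φ
  have : (N.comap φ).FiniteIndex := ⟨by
    rw [Subgroup.index_comap]
    exact fun h => Subgroup.FiniteIndex.index_ne_zero
      (zero_dvd_iff.1 (h ▸ Subgroup.relIndex_dvd_index_of_normal N φ.range))⟩
  have : B.FiniteIndex := inferInstanceAs (N ⊓ N.comap φ).FiniteIndex
  have : IsMulCommutative B := .of_setLike_mul_comm fun x hx y hy => setLike_mul_comm hx.1 hy.1
  have hk : ∀ b ∈ B, g * (φ b)⁻¹ * g⁻¹ ∈ N := fun b hb =>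
    ‹N.Normal›.conj_mem _ (N.inv_mem hb.2) g
  have key : ∀ u : G, IsSemilinearSet
      {a : Additive N | ∃ b ∈ B, a.toMul.1 * h = (u * b) * g * (φ (u * b))⁻¹} := by
    intro u
    have hmem : ∀ b ∈ B, u * (b * (g * (φ b)⁻¹ * g⁻¹)) * u⁻¹ ∈ N := fun b hb =>
      ‹N.Normal›.conj_mem _ (N.mul_mem hb.1 (hk b hb)) u
    have heq : ∀ b, (u * b) * g * (φ (u * b))⁻¹ =
        u * (b * (g * (φ b)⁻¹ * g⁻¹)) * u⁻¹ * (u * g * (φ u)⁻¹) := by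
      intro b
      rw [map_mul]
      group
    by_cases hc : ∃ c ∈ N, u * g * (φ u)⁻¹ = c * h
    · obtain ⟨c, hcN, hc⟩ := hc
      let ψ : B →* N :=
        { toFun b := ⟨u * (b.1 * (g * (φ b.1)⁻¹ * g⁻¹)) * u⁻¹, hmem b.1 b.2⟩
          map_one' := by ext; simp
          map_mul' b b' := by
            ext
            have h₁ : b'.1 * (g * (φ b.1)⁻¹ * g⁻¹) = (g * (φ b.1)⁻¹ * g⁻¹) * b'.1 :=
              setLike_mul_comm b'.2.1 (hk b.1 b.2)
            have h₂ : (φ b'.1)⁻¹ * (φ b.1)⁻¹ = (φ b.1)⁻¹ * (φ b'.1)⁻¹ :=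
              setLike_mul_comm (N.inv_mem b'.2.2) (N.inv_mem b.2.2)
            calc u * (b.1 * b'.1 * (g * (φ (b.1 * b'.1))⁻¹ * g⁻¹)) * u⁻¹
                = u * (b.1 * (b'.1 * (g * (φ b.1)⁻¹ * g⁻¹)) * (g * (φ b'.1)⁻¹ * g⁻¹)) * u⁻¹ := by
                  rw [map_mul, mul_inv_rev, h₂]
                  group
              _ = (u * (b.1 * (g * (φ b.1)⁻¹ * g⁻¹)) * u⁻¹) *
                    (u * (b'.1 * (g * (φ b'.1)⁻¹ * g⁻¹)) * u⁻¹) := by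
                  rw [h₁]
                  group }
      convert ((IsSemilinearSet.univ (M := Additive B)).image
        (MonoidHom.toAdditive ψ)).vadd (Additive.ofMul (⟨c, hcN⟩ : N)) using 1
      ext a
      simp only [Set.mem_ofPred_eq, Set.mem_vadd_set, heq, hc, ← mul_assoc _ c h, mul_left_inj]
      constructor
      · rintro ⟨b, hb, hab⟩
        refine ⟨_, ⟨Additive.ofMul ⟨b, hb⟩, Set.mem_univ _, rfl⟩, ?_⟩
        apply Additive.toMul.injective
        ext
        rw [hab]
        exact setLike_mul_comm hcN (hmem b hb)
      · rintro ⟨_, ⟨b, -, rfl⟩, rfl⟩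
        exact ⟨b.toMul.1, b.toMul.2, setLike_mul_comm hcN (hmem _ b.toMul.2)⟩
    · convert IsSemilinearSet.empty (M := Additive N)
      ext a
      simp only [Set.mem_ofPred_eq, Set.mem_empty_iff_false, iff_false]
      rintro ⟨b, hb, hab⟩
      rw [heq] at hab
      exact hc ⟨_, N.mul_mem (N.inv_mem (hmem b hb)) a.toMul.2,
        by rw [mul_assoc _ _ h, hab, inv_mul_cancel_left]⟩
  convert IsSemilinearSet.iUnion (ι := G ⧸ B) fun u => key u.out using 1
  ext a
  simp only [Set.mem_iUnion, Set.mem_ofPred_eq]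
  constructor
  · rintro ⟨x, hx⟩
    refine ⟨x, (x : G ⧸ B).out⁻¹ * x, ?_, by simpa using hx⟩
    rw [← QuotientGroup.eq]
    simp
  · rintro ⟨u, b, -, h⟩
    exact ⟨_, h⟩

theorem inducedWeight_le_iff {S : Finset G} (hgen : ∀ g : G, ∃ l : List G, (∀ s ∈ l, s ∈ S) ∧
    l.prod = g) (ω : G → ℕ) (g : G) (r : ℕ) :
    inducedWeight S ω g ≤ r ↔ ∃ l : List G, (∀ s ∈ l, s ∈ S) ∧ l.prod = g ∧ (l.map ω).sum ≤ r := by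
  rw [inducedWeight]
  split_ifs with hg
  · exact ⟨fun _ => ⟨[], by simp, hg.symm, by simp⟩, fun _ => Nat.zero_le r⟩
  · constructor
    · intro h
      obtain ⟨l, hl, hlg⟩ := hgen g
      obtain ⟨l', hl', hlg', hω⟩ := Nat.sInf_mem (s := {w : ℕ | ∃ l : List G, (∀ s ∈ l, s ∈ S) ∧
        l.prod = g ∧ (l.map ω).sum = w}) ⟨_, l, hl, hlg, rfl⟩
      exact ⟨l', hl', hlg', hω.le.trans h⟩
    · rintro ⟨l, hl, hlg, hω⟩
      exact le_trans (Nat.sInf_le ⟨l, hl, hlg, rfl⟩) hω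

theorem finite_setOf_inducedWeight_le {S : Finset G} (hgen : ∀ g : G, ∃ l : List G,
    (∀ s ∈ l, s ∈ S) ∧ l.prod = g) (ω : G → ℕ) (hω : ∀ s ∈ S, 0 < ω s) (r : ℕ) :
    {g : G | inducedWeight S ω g ≤ r}.Finite := by
  refine ((List.finite_length_le S r).image fun l => (l.map Subtype.val).prod).subset ?_
  intro g hg
  obtain ⟨l, hl, rfl, hr⟩ := (inducedWeight_le_iff hgen ω g r).1 hg
  lift l to List S using hl
  refine ⟨l, le_trans (b := ((l.map Subtype.val).map ω).sum) ?_ hr, rfl⟩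
  have h := List.card_nsmul_le_sum ((l.map Subtype.val).map ω) 1 (by
    simp only [List.mem_map]
    rintro _ ⟨_, ⟨s, -, rfl⟩, rfl⟩
    exact hω s.1 s.2)
  simpa using h

theorem Group.fg_of_forall_exists_list_prod_eq {S : Finset G} (hgen : ∀ g : G, ∃ l : List G,
    (∀ s ∈ l, s ∈ S) ∧ l.prod = g) : Group.FG G := by
  refine Group.fg_iff.2 ⟨S, ?_, S.finite_toSet⟩
  refine (Subgroup.eq_top_iff' _).2 fun g => ?_
  obtain ⟨l, hl, rfl⟩ := hgen g
  exact Subgroup.list_prod_mem _ fun s hs => Subgroup.subset_closure (hl s hs)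

open scoped IsMulCommutative in
theorem weightSeries_twistedConjugacyClass_isRational {S : Finset G} (hgen : ∀ g : G, ∃ l : List G,
    (∀ s ∈ l, s ∈ S) ∧ l.prod = g) (ω : G → ℕ) (hω : ∀ s ∈ S, 0 < ω s) (N : Subgroup G) [N.Normal]
    [N.FiniteIndex] [IsMulCommutative N] (φ : G →* G) (g : G) :
    (PowerSeries.mk fun r => (Set.ncard {h : G |
      (∃ x : G, h = x * g * (φ x)⁻¹) ∧ inducedWeight S ω h ≤ r} : ℚ)).IsRational := by
  have : Group.FG G := Group.fg_of_forall_exists_list_prod_eq hgen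
  have : Fintype (G ⧸ N) := Fintype.ofFinite _
  let i : Multiplicative (Additive N) →* G := N.subtype
  have hi : Function.Injective i := N.subtype_injective
  let t : G ⧸ N → G := Quotient.out
  have ht : ∀ h, ∃ a q, h = i (.ofAdd a) * t q := by
    intro h
    have hmem : h * (t h)⁻¹ ∈ N := by
      rw [‹N.Normal›.mem_comm_iff, ← QuotientGroup.eq]
      exact QuotientGroup.out_eq' _
    exact ⟨Additive.ofMul ⟨_, hmem⟩, h, (inv_mul_cancel_right h (t h)).symm⟩
  have htq : ∀ (a : Additive N) q, ((i (.ofAdd a) * t q : G) : G ⧸ N) = q := by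
    intro a q
    have h1 : ((i (.ofAdd a) : G) : G ⧸ N) = 1 := (QuotientGroup.eq_one_iff _).2 a.toMul.2
    rw [QuotientGroup.mk_mul, h1, one_mul]
    exact QuotientGroup.out_eq' _
  let U : G ⧸ N → Set (Additive N × ℕ) := fun q => {x | (∃ y : G,
    i (.ofAdd x.1) * t q = y * g * (φ y)⁻¹) ∧ inducedWeight S ω (i (.ofAdd x.1) * t q) ≤ x.2}
  have hU : ∀ q, IsSemilinearSet (U q) := by
    intro q
    convert (isSemilinearSet_twistedConjugacyClass N φ g (t q)).prod_univ (N := ℕ) |>.inter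
      ((isSemilinearSet_words i t hi ht S ω q).add
      ((IsSemilinearSet.univ (M := ℕ)).image (AddMonoidHom.inr (Additive N) ℕ))) using 1
    ext ⟨a, r⟩
    refine and_congr ⟨fun h => ⟨h, Set.mem_univ _⟩, fun h => h.1⟩ ?_
    rw [inducedWeight_le_iff hgen]
    constructor
    · rintro ⟨l, hl, hprod, hr⟩
      obtain ⟨k, rfl⟩ := exists_add_of_le hr
      exact ⟨(a, (l.map ω).sum), ⟨l, hl, hprod, rfl⟩, _, ⟨k, Set.mem_univ _, rfl⟩, by simp⟩
    · rintro ⟨⟨b, m⟩, ⟨l, hl, hprod, hm⟩, _, ⟨k, -, rfl⟩, hbk⟩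
      obtain ⟨h₁, h₂⟩ := Prod.ext_iff.1 hbk
      simp only [AddMonoidHom.inr_apply, Prod.fst_add, Prod.snd_add, add_zero] at h₁ h₂ hm hprod
      subst h₁
      exact ⟨l, hl, hprod, by omega⟩
  let C : ℕ → Set G := fun r =>
    {h : G | (∃ x : G, h = x * g * (φ x)⁻¹) ∧ inducedWeight S ω h ≤ r}
  have hC : ∀ r, (C r).Finite := fun r =>
    (finite_setOf_inducedWeight_le hgen ω hω r).subset fun h hh => hh.2
  let e : G ⧸ N → Additive N × ℕ → G := fun q x => i (.ofAdd x.1) * t q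
  have he : ∀ q r, Set.InjOn (e q) {x ∈ U q | AddMonoidHom.snd _ ℕ x = r} := by
    rintro q r ⟨a, m⟩ ⟨-, rfl⟩ ⟨b, n⟩ ⟨-, hn⟩ hab
    exact Prod.ext (hi (mul_right_cancel hab)) hn.symm
  have hUC : ∀ q r, e q '' {x ∈ U q | AddMonoidHom.snd _ ℕ x = r} =
      {h ∈ C r | (h : G ⧸ N) = q} := by
    intro q r
    ext h
    constructor
    · rintro ⟨⟨a, m⟩, ⟨hx, rfl⟩, rfl⟩
      exact ⟨hx, htq a q⟩
    · rintro ⟨hh, rfl⟩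
      obtain ⟨a, q, rfl⟩ := ht h
      rw [htq]
      exact ⟨(a, r), ⟨hh, rfl⟩, rfl⟩
  have hUfin : ∀ q r, {x ∈ U q | AddMonoidHom.snd _ ℕ x = r}.Finite := fun q r =>
    Set.Finite.of_finite_image (hUC q r ▸ (hC r).subset (Set.sep_subset _ _)) (he q r)
  convert PowerSeries.IsRational.sum Finset.univ fun q _ =>
    (hU q).weightSeries_isRational (AddMonoidHom.snd (Additive N) ℕ) (hUfin q) using 1
  ext r
  simp only [map_sum, weightSeries, PowerSeries.coeff_mk]
  change ((C r).ncard : ℚ) = _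
  rw [← Nat.cast_sum]
  congr 1
  simp_rw [← (he _ r).ncard_image, hUC]
  rw [Set.ncard_eq_toFinset_card _ (hC r),
    Finset.card_eq_sum_card_fiberwise (f := fun h : G => (h : G ⧸ N)) (t := Finset.univ) (by simp)]
  refine Finset.sum_congr rfl fun q _ => ?_
  rw [← Set.ncard_coe_finset]
  congr 1
  ext h
  simp

end TwistedConjugacy

end

/-- Let `G` be a finitely generated virtually abelian group, `S` a finite
monoid generating set with weight function `ω : S → ℕ₊`, and `φ` an endomorphism of `G`.
Fix `g ∈ G` and let `b r` be the number of elements `h` of the `φ`-twisted conjugacy class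
`[g]_φ` with weight at most `r`. Then the relative growth series `∑ b(r) zʳ` is a rational
power series. -/
theorem twisted_conjugacy_class_relative_growth_series_rational {G : Type*} [Group G]
    (hVA : ∃ A : Subgroup G, A.index ≠ 0 ∧ ∀ x ∈ A, ∀ y ∈ A, x * y = y * x)
    (S : Finset G) (hgen : ∀ g : G, ∃ l : List G, (∀ s ∈ l, s ∈ S) ∧ l.prod = g)
    (ω : G → ℕ) (hω : ∀ s ∈ S, 0 < ω s) (φ : G →* G) (g : G)
    (b : ℕ → ℕ)
    (hb : ∀ r : ℕ, b r = Set.ncard {h : G |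
      (∃ x : G, h = x * g * (φ x)⁻¹) ∧ inducedWeight S ω h ≤ r}) :
    ∃ p q : Polynomial ℚ, q.coeff 0 ≠ 0 ∧
      (q : PowerSeries ℚ) * PowerSeries.mk (fun r => (b r : ℚ)) = (p : PowerSeries ℚ) := by
  obtain ⟨A, hA, hcomm⟩ := hVA
  have : A.FiniteIndex := ⟨hA⟩
  have : IsMulCommutative A.normalCore := .of_setLike_mul_comm fun x hx y hy =>
    hcomm x (A.normalCore_le hx) y (A.normalCore_le hy)
  simp_rw [hb]
  exact weightSeries_twistedConjugacyClass_isRational hgen ω hω A.normalCore φ g
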